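/- arXiv:1308.3056 — 4 statements merged into one kernel-verified Lean document; each statement's English description precedes it below -/
import Mathlib

section
/- Let A be a real 2d×2d symplectic matrix with polar decomposition A = OP, and set 𝒬_A := I + P² and ℛ_A := O(I − P²)𝒬_A⁻¹J₀Oᵗ. Then ℛ_A is a symmetric matrix. -/
open Matrix

noncomputable section

/-- Index type for `ℝ^{2d} ≅ ℝ^d ⊕ ℝ^d`. -/
abbrev Idx (d : ℕ) := Fin d ⊕ Fin d

/-- The matrix `J₀ = [[0, -I_d],[I_d, 0]]` of the standard complex structure on `ℝ^{2d}`. -/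
def J0 (d : ℕ) : Matrix (Idx d) (Idx d) ℝ := fromBlocks 0 (-1) 1 0

/-- A real `2d × 2d` matrix is symplectic if `Aᵗ J₀ A = J₀`. -/
def IsSymplectic {d : ℕ} (A : Matrix (Idx d) (Idx d) ℝ) : Prop :=
  Aᵀ * J0 d * A = J0 d

/-- `𝒬_A := I + P²`, where `P` is the positive factor of the polar decomposition. -/
def QA {d : ℕ} (P : Matrix (Idx d) (Idx d) ℝ) : Matrix (Idx d) (Idx d) ℝ := 1 + P * P

/-- `ℛ_A := O (I − P²) 𝒬_A⁻¹ J₀ Oᵗ`. -/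
def RA {d : ℕ} (O P : Matrix (Idx d) (Idx d) ℝ) : Matrix (Idx d) (Idx d) ℝ :=
  O * (1 - P * P) * (QA P)⁻¹ * J0 d * Oᵀ

theorem J0_transpose (d : ℕ) : (J0 d)ᵀ = -J0 d := by
  simp [J0, fromBlocks_transpose, fromBlocks_neg]

theorem J0_mul_J0 (d : ℕ) : J0 d * J0 d = -1 := by
  rw [← fromBlocks_one, fromBlocks_neg]
  simp [J0, fromBlocks_multiply]

/-- The transpose of a symplectic matrix is symplectic. -/
theorem IsSymplectic.mul_J0_mul_transpose {d : ℕ} {A : Matrix (Idx d) (Idx d) ℝ}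
    (hA : IsSymplectic A) : A * J0 d * Aᵀ = J0 d := by
  have hleft : -(J0 d * Aᵀ * J0 d) * A = 1 := by
    rw [Matrix.neg_mul, Matrix.mul_assoc, Matrix.mul_assoc, ← Matrix.mul_assoc Aᵀ,
      show Aᵀ * J0 d * A = J0 d from hA, J0_mul_J0, neg_neg]
  have hright : A * -(J0 d * Aᵀ * J0 d) = 1 := mul_eq_one_comm.mp hleft
  calc A * J0 d * Aᵀ = -(A * J0 d * Aᵀ * (J0 d * J0 d)) := by simp [J0_mul_J0]
    _ = A * -(J0 d * Aᵀ * J0 d) * J0 d := by noncomm_ring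
    _ = J0 d := by rw [hright, Matrix.one_mul]

theorem one_sub_mul_inv_one_add_comm {n : Type*} [Fintype n] [DecidableEq n]
    {S : Matrix n n ℝ} (hS : IsUnit (1 + S).det) :
    (1 - S) * (1 + S)⁻¹ = (1 + S)⁻¹ * (1 - S) := by
  calc (1 - S) * (1 + S)⁻¹ = (1 + S)⁻¹ * (1 + S) * (1 - S) * (1 + S)⁻¹ := by
        rw [nonsing_inv_mul _ hS, Matrix.one_mul]
    _ = (1 + S)⁻¹ * (1 - S) * ((1 + S) * (1 + S)⁻¹) := by noncomm_ring
    _ = (1 + S)⁻¹ * (1 - S) := by rw [mul_nonsing_inv _ hS, Matrix.mul_one]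

/-- If `S * J * S = J`, then `J` anticommutes with the Cayley transform of `S`. -/
theorem cayley_mul_eq_neg_mul_cayley {n : Type*} [Fintype n] [DecidableEq n]
    {S J : Matrix n n ℝ} (hSJS : S * J * S = J) (hS : IsUnit (1 + S).det) :
    (1 - S) * (1 + S)⁻¹ * J = -(J * ((1 - S) * (1 + S)⁻¹)) := by
  have h : (1 - S) * J * (1 + S) = -((1 + S) * J * (1 - S)) := by
    calc (1 - S) * J * (1 + S) = J - S * J + J * S - S * J * S := by noncomm_ring
      _ = -(J + S * J - J * S - S * J * S) := by rw [hSJS]; abel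
      _ = -((1 + S) * J * (1 - S)) := by noncomm_ring
  calc (1 - S) * (1 + S)⁻¹ * J
      = (1 + S)⁻¹ * ((1 - S) * J) * ((1 + S) * (1 + S)⁻¹) := by
        rw [one_sub_mul_inv_one_add_comm hS, mul_nonsing_inv _ hS, Matrix.mul_one,
          Matrix.mul_assoc]
    _ = (1 + S)⁻¹ * ((1 - S) * J * (1 + S)) * (1 + S)⁻¹ := by simp only [Matrix.mul_assoc]
    _ = -((1 + S)⁻¹ * (1 + S) * (J * ((1 - S) * (1 + S)⁻¹))) := by
        rw [h]
        simp only [Matrix.mul_assoc, Matrix.neg_mul, Matrix.mul_neg]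
    _ = -(J * ((1 - S) * (1 + S)⁻¹)) := by rw [nonsing_inv_mul _ hS, Matrix.one_mul]

/-- For a symplectic `A` with polar decomposition `A = O * P`, the matrix
`ℛ_A = O (I − P²) (I + P²)⁻¹ J₀ Oᵗ` is symmetric. -/
theorem RA_symm {d : ℕ} (hd : 1 ≤ d)
    (A O P : Matrix (Idx d) (Idx d) ℝ)
    (hA : IsSymplectic A) (hpolar : A = O * P)
    (hO : Oᵀ * O = 1) (hPsymm : Pᵀ = P) (hPpos : P.PosDef) :
    (RA O P)ᵀ = RA O P := by
  have hAA : Aᵀ * A = P * P := by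
    rw [hpolar, transpose_mul, hPsymm, Matrix.mul_assoc, ← Matrix.mul_assoc Oᵀ, hO,
      Matrix.one_mul]
  have hPJP : P * P * J0 d * (P * P) = J0 d := by
    rw [← hAA]
    calc Aᵀ * A * J0 d * (Aᵀ * A) = Aᵀ * (A * J0 d * Aᵀ) * A := by noncomm_ring
      _ = J0 d := by rw [hA.mul_J0_mul_transpose]; exact hA
  have hQ : IsUnit (1 + P * P).det := by
    have hPP : (P * P).PosSemidef := by
      simpa [conjTranspose_eq_transpose_of_trivial, hPsymm] using
        posSemidef_conjTranspose_mul_self P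
    exact (PosDef.one.add_posSemidef hPP).det_pos.ne'.isUnit
  have key := cayley_mul_eq_neg_mul_cayley hPJP hQ
  have hcomm := one_sub_mul_inv_one_add_comm hQ
  simp only [RA, QA, transpose_mul, transpose_transpose, transpose_nonsing_inv, transpose_add,
    transpose_sub, transpose_one, hPsymm, J0_transpose]
  calc O * (-J0 d * ((1 + P * P)⁻¹ * ((1 - P * P) * Oᵀ)))
      = O * -(J0 d * ((1 + P * P)⁻¹ * (1 - P * P))) * Oᵀ := by
        simp only [Matrix.mul_assoc, Matrix.neg_mul]
    _ = O * (1 - P * P) * (1 + P * P)⁻¹ * J0 d * Oᵀ := by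
        rw [← hcomm, ← key]
        simp only [Matrix.mul_assoc]
end
end

section
/- Let A be a real 2d×2d symplectic matrix and let 𝔔_A(v) := −S_A(v,v). Then Re 𝔔_A(v) ≥ 0 for every v ∈ ℝ^{2d}, and Re 𝔔_A(v) = 0 if and only if Av = v. -/
open Matrix

noncomputable section

/-- The standard symplectic form `ω₀(r,s) = -rᵗ J₀ s` on `ℝ^{2d}`. -/
def omega0 {d : ℕ} (u v : Idx d → ℝ) : ℝ := -(u ⬝ᵥ (J0 d).mulVec v)

/-- `𝒫_A := O 𝒬_A⁻¹ Oᵗ`. -/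
def PA {d : ℕ} (O P : Matrix (Idx d) (Idx d) ℝ) : Matrix (Idx d) (Idx d) ℝ :=
  O * (QA P)⁻¹ * Oᵀ

/-- `L_A(u,w) := A u − w`. -/
def LA {d : ℕ} (A : Matrix (Idx d) (Idx d) ℝ) (u w : Idx d → ℝ) : Idx d → ℝ :=
  A.mulVec u - w

/-- The quadratic phase
`S_A(u,w) := −L_A(u,w)ᵗ [𝒫_A + (i/2) ℛ_A] L_A(u,w) − i ω₀(Au, w)`. -/
def SA {d : ℕ} (A O P : Matrix (Idx d) (Idx d) ℝ) (u w : Idx d → ℝ) : ℂ :=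
  -((LA A u w ⬝ᵥ (PA O P).mulVec (LA A u w) : ℝ) : ℂ)
    - (Complex.I / 2) * ((LA A u w ⬝ᵥ (RA O P).mulVec (LA A u w) : ℝ) : ℂ)
    - Complex.I * ((omega0 (A.mulVec u) w : ℝ) : ℂ)

/-- `𝔔_A(v) := −S_A(v,v)`. -/
def Qfrak {d : ℕ} (A O P : Matrix (Idx d) (Idx d) ℝ) (v : Idx d → ℝ) : ℂ :=
  - SA A O P v v

theorem posDef_one_add_mul_self {n : Type*} [Fintype n] [DecidableEq n] {P : Matrix n n ℝ}
    (hP : Pᵀ = P) : (1 + P * P).PosDef := by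
  have h := posSemidef_conjTranspose_mul_self P
  rw [conjTranspose_eq_transpose_of_trivial, hP] at h
  exact PosDef.one.add_posSemidef h

theorem posDef_PA {d : ℕ} {O P : Matrix (Idx d) (Idx d) ℝ} (hO : Oᵀ * O = 1) (hP : Pᵀ = P) :
    (PA O P).PosDef := by
  have hinj : Function.Injective O.vecMul :=
    vecMul_injective_of_isUnit (IsUnit.of_mul_eq_one_right _ hO)
  simpa [PA, QA] using (posDef_one_add_mul_self hP).inv.mul_mul_conjTranspose_same hinj

theorem re_Qfrak {d : ℕ} (A O P : Matrix (Idx d) (Idx d) ℝ) (v : Idx d → ℝ) :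
    (Qfrak A O P v).re = LA A v v ⬝ᵥ PA O P *ᵥ LA A v v := by
  simp [Qfrak, SA]

/-- For a symplectic `A` with polar decomposition `A = O * P`:
`Re 𝔔_A(v) ≥ 0` for every `v`, with equality iff `Av = v`. -/
theorem re_Qfrak_nonneg {d : ℕ} (hd : 1 ≤ d)
    (A O P : Matrix (Idx d) (Idx d) ℝ)
    (hA : IsSymplectic A) (hpolar : A = O * P)
    (hO : Oᵀ * O = 1) (hPsymm : Pᵀ = P) (hPpos : P.PosDef)
    (v : Idx d → ℝ) :
    0 ≤ (Qfrak A O P v).re ∧ ((Qfrak A O P v).re = 0 ↔ A.mulVec v = v) := by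
  have hPA := posDef_PA hO hPsymm
  rw [re_Qfrak]
  refine ⟨by simpa using hPA.posSemidef.dotProduct_mulVec_nonneg (LA A v v), fun h => ?_, fun h => ?_⟩
  · by_contra hne
    have hpos := hPA.dotProduct_mulVec_pos (x := LA A v v) (sub_ne_zero.mpr hne)
    rw [star_trivial] at hpos
    exact hpos.ne' h
  · simp [LA, h]
end
end

section
/- Let A be a real 2d×2d symplectic matrix. Then ker(I − A) ∩ im(I − A) = {0} if and only if the restriction of the standard symplectic form ω₀ to the subspace ker(I − A) is nondegenerate (i.e. ker(I − A) is a symplectic subspace of (ℝ^{2d}, ω₀)). -/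
open Matrix

noncomputable section

/-- Fredholm alternative for matrices over a field: `v` lies in the range of `M` once it is
orthogonal to the kernel of `Mᵀ`. -/
theorem exists_mulVec_eq_of_forall_vecMul_eq_zero {K m n : Type*} [Field K] [Fintype m]
    [Fintype n] [DecidableEq m] (M : Matrix m n K) (v : m → K)
    (h : ∀ y : m → K, y ᵥ* M = 0 → y ⬝ᵥ v = 0) : ∃ x, M *ᵥ x = v := by
  by_contra hv
  obtain ⟨f, hfv, hf⟩ :=
    Submodule.exists_le_ker_of_notMem (p := LinearMap.range M.mulVecLin) (v := v) hv
  obtain ⟨y, rfl⟩ := (dotProductEquiv K m).surjective f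
  refine hfv (h y (dotProduct_eq_zero _ fun x => ?_))
  rw [← dotProduct_mulVec]
  exact hf ⟨x, rfl⟩

theorem omega0_mulVec_mulVec {d : ℕ} {A : Matrix (Idx d) (Idx d) ℝ} (hA : IsSymplectic A)
    (u v : Idx d → ℝ) : omega0 (A *ᵥ u) (A *ᵥ v) = omega0 u v := by
  unfold omega0
  rw [← vecMul_transpose, ← dotProduct_mulVec, mulVec_mulVec, mulVec_mulVec, hA]

/-- A vector fixed by `Aᵀ` is sent by `J₀` to a vector fixed by `A`. -/
theorem mulVec_J0_mulVec_of_vecMul_eq {d : ℕ} {A : Matrix (Idx d) (Idx d) ℝ}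
    (hA : IsSymplectic A) {y : Idx d → ℝ} (hy : y ᵥ* A = y) :
    A *ᵥ (J0 d *ᵥ y) = J0 d *ᵥ y := by
  have hinv : (-(J0 d * Aᵀ * J0 d)) * A = 1 := by
    rw [neg_mul, mul_assoc (J0 d), mul_assoc (J0 d), hA, J0_mul_J0, neg_neg]
  have hinv' : A * (J0 d * Aᵀ * J0 d) = -1 := by
    rw [← mul_eq_one_comm.mp hinv, mul_neg, neg_neg]
  have hAJ : A * J0 d * Aᵀ = J0 d := by
    have h := congrArg (fun M => M * J0 d) hinv'
    simpa [mul_assoc, J0_mul_J0] using h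
  rw [← mulVec_transpose] at hy
  conv_lhs => rw [← hy]
  rw [mulVec_mulVec, mulVec_mulVec, hAJ]

/-- The range of `1 - A` is the symplectic complement of the kernel of `1 - A`. -/
theorem exists_one_sub_mulVec_eq_iff {d : ℕ} {A : Matrix (Idx d) (Idx d) ℝ}
    (hA : IsSymplectic A) (v : Idx d → ℝ) :
    (∃ x, (1 - A) *ᵥ x = v) ↔ ∀ w, A *ᵥ w = w → omega0 v w = 0 := by
  constructor
  · rintro ⟨x, rfl⟩ w hw
    have h := omega0_mulVec_mulVec hA x w
    rw [hw] at h
    unfold omega0 at h ⊢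
    rw [sub_mulVec, one_mulVec, sub_dotProduct]
    linarith
  · intro h
    refine exists_mulVec_eq_of_forall_vecMul_eq_zero _ v fun y hy => ?_
    rw [vecMul_sub, vecMul_one, sub_eq_zero] at hy
    have h' := h _ (mulVec_J0_mulVec_of_vecMul_eq hA hy.symm)
    rw [omega0, mulVec_mulVec, J0_mul_J0, neg_mulVec, one_mulVec, dotProduct_neg, neg_neg] at h'
    rwa [dotProduct_comm]

/-- For a symplectic matrix `A`, `ker(I − A) ∩ im(I − A) = {0}` iff the restriction of
`ω₀` to `ker(I − A)` is nondegenerate, i.e. `ker(I − A)` is a symplectic subspace. -/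
theorem ker_inter_im_trivial_iff_ker_symplectic {d : ℕ} (hd : 1 ≤ d)
    (A : Matrix (Idx d) (Idx d) ℝ) (hA : IsSymplectic A) :
    ({v : Idx d → ℝ | A.mulVec v = v} ∩
        {v : Idx d → ℝ | ∃ x : Idx d → ℝ, (1 - A).mulVec x = v} = {0}) ↔
      (∀ v : Idx d → ℝ, A.mulVec v = v →
        (∀ w : Idx d → ℝ, A.mulVec w = w → omega0 v w = 0) → v = 0) := by
  have h : ∀ v, v ∈ {v : Idx d → ℝ | A.mulVec v = v} ∩
      {v : Idx d → ℝ | ∃ x : Idx d → ℝ, (1 - A).mulVec x = v} ↔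
      A *ᵥ v = v ∧ ∀ w, A *ᵥ w = w → omega0 v w = 0 := fun v =>
    and_congr_right fun _ => exists_one_sub_mulVec_eq_iff hA v
  constructor
  · intro heq v hv hw
    have hmem := (h v).mpr ⟨hv, hw⟩
    rwa [heq] at hmem
  · intro hnd
    ext v
    rw [h v, Set.mem_singleton_iff]
    constructor
    · exact fun hv => hnd v hv.1 hv.2
    · rintro rfl
      simp [omega0]
end
end

section
/- Let A be a real 2d×2d symplectic matrix such that ker(I − A) ∩ im(I − A) = {0}. Then there exists a constant C > 0 such that Re 𝔔_A(v) ≥ C‖v‖² for every v ∈ im(I − A), where ‖·‖ is the Euclidean norm on ℝ^{2d}. -/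
open Matrix

noncomputable section

/-- A quadratic form that is positive on the nonzero vectors of a subspace is coercive there. -/
theorem exists_coercive_of_pos_on_submodule {ι : Type*} [Fintype ι] (N : Matrix ι ι ℝ)
    (W : Submodule ℝ (ι → ℝ)) (hN : ∀ v ∈ W, v ≠ 0 → 0 < v ⬝ᵥ N *ᵥ v) :
    ∃ C > (0 : ℝ), ∀ v ∈ W, C * (v ⬝ᵥ v) ≤ v ⬝ᵥ N *ᵥ v := by
  have hK : IsCompact (Metric.sphere (0 : ι → ℝ) 1 ∩ W) :=
    (isCompact_sphere _ _).inter_right W.closed_of_finiteDimensional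
  have hne : ∀ v ∈ Metric.sphere (0 : ι → ℝ) 1 ∩ W, v ≠ 0 := fun v hv =>
    ne_zero_of_mem_unit_sphere ⟨v, hv.1⟩
  have hsq : ∀ v : ι → ℝ, v ≠ 0 → 0 < v ⬝ᵥ v := fun v hv =>
    lt_of_le_of_ne (by simpa using dotProduct_star_self_nonneg v)
      fun h => hv (dotProduct_self_eq_zero.1 h.symm)
  have hcont : ContinuousOn (fun v : ι → ℝ => (v ⬝ᵥ N *ᵥ v) / (v ⬝ᵥ v))
      (Metric.sphere (0 : ι → ℝ) 1 ∩ W) :=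
    ContinuousOn.div (by fun_prop) (by fun_prop) fun v hv => (hsq v (hne v hv)).ne'
  obtain ⟨C, hC, hle⟩ := hK.exists_forall_le' hcont (a := 0)
    fun v hv => div_pos (hN v hv.2 (hne v hv)) (hsq v (hne v hv))
  refine ⟨C, hC, fun v hv => ?_⟩
  obtain rfl | h0 := eq_or_ne v 0
  · simp
  have hnorm : ‖v‖⁻¹ ≠ 0 := inv_ne_zero (norm_ne_zero_iff.2 h0)
  have h := hle (‖v‖⁻¹ • v) ⟨by simp [norm_smul, h0], W.smul_mem _ hv⟩
  simp only [mulVec_smul, smul_dotProduct, dotProduct_smul, smul_eq_mul] at h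
  rwa [mul_div_mul_left _ _ hnorm, mul_div_mul_left _ _ hnorm, le_div_iff₀ (hsq v h0)] at h

theorem Qfrak_re {d : ℕ} (A O P : Matrix (Idx d) (Idx d) ℝ) (v : Idx d → ℝ) :
    (Qfrak A O P v).re = LA A v v ⬝ᵥ (PA O P).mulVec (LA A v v) := by
  simp [Qfrak, SA]

/-- If `A` is symplectic with `ker(I − A) ∩ im(I − A) = {0}`, then there is `C > 0` with
`Re 𝔔_A(v) ≥ C ‖v‖²` for all `v ∈ im(I − A)` (here `v ⬝ᵥ v = ‖v‖²` is the squared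
Euclidean norm). -/
theorem re_Qfrak_coercive_on_image {d : ℕ} (hd : 1 ≤ d)
    (A O P : Matrix (Idx d) (Idx d) ℝ)
    (hA : IsSymplectic A) (hpolar : A = O * P)
    (hO : Oᵀ * O = 1) (hPsymm : Pᵀ = P) (hPpos : P.PosDef)
    (hclean : {v : Idx d → ℝ | A.mulVec v = v} ∩
        {v : Idx d → ℝ | ∃ x : Idx d → ℝ, (1 - A).mulVec x = v} = {0}) :
    ∃ C > (0 : ℝ), ∀ v : Idx d → ℝ,
      (∃ x : Idx d → ℝ, (1 - A).mulVec x = v) → C * (v ⬝ᵥ v) ≤ (Qfrak A O P v).re := by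
  have hLA : ∀ v, LA A v v = (A - 1) *ᵥ v := fun v => by simp [LA, sub_mulVec]
  have hre : ∀ v, (Qfrak A O P v).re = v ⬝ᵥ ((A - 1)ᵀ * PA O P * (A - 1)) *ᵥ v := fun v => by
    rw [Qfrak_re, hLA, ← mulVec_mulVec, ← mulVec_mulVec, dotProduct_mulVec v, vecMul_transpose]
  obtain ⟨C, hC, hle⟩ := exists_coercive_of_pos_on_submodule
    ((A - 1)ᵀ * PA O P * (A - 1)) (LinearMap.range (1 - A).mulVecLin) fun v hv hv0 => by
      have hL : LA A v v ≠ 0 := fun h =>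
        hv0 (hclean.subset ⟨sub_eq_zero.1 h, hv⟩)
      rw [← hre, Qfrak_re]
      simpa using (posDef_PA hO hPsymm).dotProduct_mulVec_pos hL
  exact ⟨C, hC, fun v hv => (hre v).symm ▸ hle v hv⟩
end
end
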